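/- For every smooth function L on ℝ^{2n+1}, the n-form E(Lβ) is effective: χ ⌟ E(Lβ) = 0 and ⊥E(Lβ) = 0. -/

import Mathlib

noncomputable section

namespace MA

/-- Points / tangent vectors of ℝ^m. -/
abbrev Vec (m : ℕ) := Fin m → ℝ

/-- An (unbundled) differential `k`-form on ℝ^m : at each point it eats a
`k`-tuple of tangent vectors and returns a real number. -/
abbrev Form (m k : ℕ) := Vec m → (Fin k → Vec m) → ℝ

/-- `ω` is pointwise an alternating multilinear map, i.e. a genuine exterior form. -/
def IsForm {m k : ℕ} (ω : Form m k) : Prop :=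
  ∀ x : Vec m, ∃ a : AlternatingMap ℝ (Vec m) ℝ (Fin k), ∀ v, ω x v = a v

/-- Smoothness of a differential form (smoothness of all coefficients). -/
def SmoothForm {m k : ℕ} (ω : Form m k) : Prop :=
  ∀ v : Fin k → Vec m, ContDiff ℝ (⊤ : ℕ∞) fun x => ω x v

/-- Multiplication of a form by a scalar function. -/
def fsmul {m k : ℕ} (f : Vec m → ℝ) (ω : Form m k) : Form m k := fun x v => f x * ω x v

/-- Wedge (exterior) product of differential forms. -/
def wedge {m k l : ℕ} (ω : Form m k) (η : Form m l) : Form m (k + l) := fun x v =>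
  ((k.factorial * l.factorial : ℕ) : ℝ)⁻¹ *
    ∑ σ : Equiv.Perm (Fin (k + l)),
      ((Equiv.Perm.sign σ : ℤ) : ℝ) *
        (ω x fun i => v (σ (Fin.castAdd l i))) *
        (η x fun j => v (σ (Fin.natAdd k j)))

/-- Interior product (contraction) of a form with a (constant) vector. -/
def iprod {m : ℕ} (u : Vec m) : ∀ {k : ℕ}, Form m k → Form m (k - 1)
  | 0, _ => 0
  | _ + 1, ω => fun x v => ω x (Fin.cons u v)

/-- Exterior derivative of a differential form (coordinate formula). -/
def exd {m k : ℕ} (ω : Form m k) : Form m (k + 1) := fun x v =>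
  ∑ i : Fin (k + 1),
    (-1 : ℝ) ^ (i : ℕ) * fderiv ℝ (fun y => ω y fun j => v (i.succAbove j)) x (v i)

/-- Change the (propositionally equal) degree of a form. -/
def reindex {m k l : ℕ} (h : k = l) (ω : Form m k) : Form m l :=
  fun x v => ω x fun i => v (Fin.cast h i)

/-- Pullback of a differential form along a map. -/
def pullback {a b k : ℕ} (f : Vec a → Vec b) (ω : Form b k) : Form a k :=
  fun x v => ω (f x) fun i => fderiv ℝ f x (v i)

/-- `i`-th standard basis vector of ℝ^m. -/
def basisVec {m : ℕ} (i : Fin m) : Vec m := Pi.single i 1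

/-- The coordinate 1-form `dx^i`. -/
def dx {m : ℕ} (i : Fin m) : Form m 1 := fun _ v => v 0 i

/-- Partial derivative of a function in the `i`-th coordinate direction. -/
def pd {m : ℕ} (i : Fin m) (f : Vec m → ℝ) : Vec m → ℝ := fun x => fderiv ℝ f x (basisVec i)

/- Jet-space coordinates on J¹ℝⁿ = ℝ^{2n+1} : (q¹,…,qⁿ,u,p₁,…,pₙ). -/

/-- Index of the coordinate `q^μ`. -/
def qIdx {n : ℕ} (μ : Fin n) : Fin (2 * n + 1) := ⟨μ, by have := μ.isLt; omega⟩

/-- Index of the coordinate `u`. -/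
def uIdx {n : ℕ} : Fin (2 * n + 1) := ⟨n, by omega⟩

/-- Index of the coordinate `p_μ`. -/
def pIdx {n : ℕ} (μ : Fin n) : Fin (2 * n + 1) := ⟨n + 1 + μ, by have := μ.isLt; omega⟩

/-- The Reeb field `χ = ∂/∂u` (a constant vector field). -/
def chi {n : ℕ} : Vec (2 * n + 1) := basisVec uIdx

/-- The standard contact form `c = du - Σ p_μ dq^μ` on J¹ℝⁿ. -/
def contact {n : ℕ} : Form (2 * n + 1) 1 := fun x v =>
  v 0 uIdx - ∑ μ : Fin n, x (pIdx μ) * v 0 (qIdx μ)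

/-- The symplectic-type 2-form `Ω = dc = Σ dq^μ ∧ dp_μ`. -/
def symp {n : ℕ} : Form (2 * n + 1) 2 := ∑ μ : Fin n, wedge (dx (qIdx μ)) (dx (pIdx μ))

/-- The bottom operator `⊥ = Σ_μ ∂_{p_μ} ⌟ ∂_{q^μ} ⌟ ·` (zero on forms of degree ≤ 1). -/
def botOp {n k : ℕ} (ω : Form (2 * n + 1) k) : Form (2 * n + 1) (k - 2) :=
  ∑ μ : Fin n, iprod (basisVec (pIdx μ)) (iprod (basisVec (qIdx μ)) ω)

/-- A form is effective if it is killed by `χ ⌟ ·` and by `⊥`. -/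
def Effective {n k : ℕ} (ω : Form (2 * n + 1) k) : Prop :=
  iprod (chi (n := n)) ω = 0 ∧ botOp ω = 0

/-- The projection `p(α) = α - c ∧ (χ ⌟ α)` onto forms annihilated by `χ ⌟ ·`. -/
def proj {n : ℕ} : ∀ {k : ℕ}, Form (2 * n + 1) k → Form (2 * n + 1) k
  | 0, α => α
  | j + 1, α => α - reindex (Nat.add_comm 1 j) (wedge contact (iprod (chi (n := n)) α))

/-- The projected exterior derivative `d_p = p ∘ d`. -/
def dproj {n k : ℕ} (ω : Form (2 * n + 1) k) : Form (2 * n + 1) (k + 1) := proj (exd ω)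

/-- Lie derivative along the (constant) Reeb field `χ`. -/
def lieChi {n k : ℕ} (ω : Form (2 * n + 1) k) : Form (2 * n + 1) k := fun x v =>
  fderiv ℝ (fun y => ω y v) x (chi (n := n))

/-- The Euler operator `E = d_p ∘ ⊥ ∘ d_p + L_χ` on n-forms over J¹ℝⁿ. -/
def euler : ∀ {n : ℕ}, Form (2 * n + 1) n → Form (2 * n + 1) n
  | 0, ω => lieChi ω
  | n + 1, ω =>
    reindex (show n + 1 + 1 - 2 + 1 = n + 1 by omega) (dproj (botOp (dproj ω))) + lieChi ω

/-- The horizontal volume form `β = dq¹ ∧ … ∧ dqⁿ` on J¹ℝⁿ. -/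
def qvol {n : ℕ} : Form (2 * n + 1) n := fun _ v =>
  Matrix.det (Matrix.of fun i j : Fin n => v i (qIdx j))

/-- The volume form `β = dq¹ ∧ … ∧ dqⁿ` on the base ℝⁿ. -/
def baseVol {n : ℕ} : Form n n := fun _ v => Matrix.det (Matrix.of fun i j : Fin n => v i j)

/-- `β_μ = ∂_{q^μ} ⌟ β`. -/
def betaMu {n : ℕ} (μ : Fin n) : Form (2 * n + 1) (n - 1) := iprod (basisVec (qIdx μ)) qvol

/-- The first jet prolongation `j¹φ : ℝⁿ → ℝ^{2n+1}`, `x ↦ (x, φ(x), ∂₁φ(x), …, ∂ₙφ(x))`. -/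
def jet {n : ℕ} (φ : Vec n → ℝ) (x : Vec n) : Vec (2 * n + 1) := fun i =>
  if h : (i : ℕ) < n then x ⟨i, h⟩
  else if h2 : (i : ℕ) = n then φ x
  else fderiv ℝ φ x (basisVec ⟨(i : ℕ) - (n + 1), by have := i.isLt; omega⟩)

/-- Second partial derivative `φ_{μν} = ∂²φ/∂q^μ∂q^ν`. -/
def d2 {n : ℕ} (φ : Vec n → ℝ) (μ ν : Fin n) : Vec n → ℝ := fun x =>
  fderiv ℝ (fun y => fderiv ℝ φ y (basisVec ν)) x (basisVec μ)

/-- A form is multisymplectic if it is closed and pointwise nondegenerate. -/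
def Multisymplectic {m k : ℕ} (μ : Form m k) : Prop :=
  exd μ = 0 ∧ ∀ (x v : Vec m), iprod v μ x = 0 → v = 0

/-- Lift a form on J¹ℝⁿ = ℝ^{2n+1} to ℝ^{2n+2} = J¹ℝⁿ × ℝ (extra coordinate `e`)
along the projection. -/
def liftForm {n k : ℕ} (ω : Form (2 * n + 1) k) : Form (2 * n + 1 + 1) k :=
  pullback (fun y (i : Fin (2 * n + 1)) => y i.castSucc) ω

/-- The 1-form `de` on ℝ^{2n+2}. -/
def deForm {n : ℕ} : Form (2 * n + 1 + 1) 1 := dx (Fin.last (2 * n + 1))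

/-- The (n+1)-form `m_ω = de ∧ β + c ∧ ω` on ℝ^{2n+2}. -/
def msf {n : ℕ} (ω : Form (2 * n + 1) n) : Form (2 * n + 1 + 1) (n + 1) :=
  reindex (Nat.add_comm 1 n) (wedge (deForm (n := n)) (liftForm qvol)) +
    reindex (Nat.add_comm 1 n) (wedge (liftForm (contact (n := n))) (liftForm ω))

/-- Antisymmetry of a form: permuting the arguments multiplies the value by the sign. -/
def IsAntisymm {m k : ℕ} (ω : Form m k) : Prop :=
  ∀ (x : Vec m) (v : Fin k → Vec m) (τ : Equiv.Perm (Fin k)),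
    ω x (fun i => v (τ i)) = ((Equiv.Perm.sign τ : ℤ) : ℝ) * ω x v

/-- A form is horizontal if it vanishes as soon as one argument is the Reeb field. -/
def IsHorizontal {n k : ℕ} (ω : Form (2 * n + 1) k) : Prop :=
  ∀ (x : Vec (2 * n + 1)) (v : Fin k → Vec (2 * n + 1)) (i : Fin k),
    v i = chi (n := n) → ω x v = 0

theorem IsAntisymm.swap_zero {m k : ℕ} {ω : Form m k} (hω : IsAntisymm ω) (x : Vec m)
    (v : Fin (k + 1) → Vec m) (p : Fin (k + 1)) :
    (if p = 0 then 1 else -1 : ℝ) * ω x (fun i => v (Equiv.swap 0 p i.succ)) =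
      (-1) ^ (p : ℕ) * ω x (fun i => v (p.succAbove i)) := by
  cases k with
  | zero =>
    obtain rfl : p = 0 := Fin.fin_one_eq_zero p
    simp
  | succ k =>
    cases p using Fin.cases with
    | zero => simp
    | succ i =>
      have h := hω x (fun j => v (i.succ.succAbove j)) i.cycleRange
      simp only [Fin.succAbove_cycleRange, Fin.sign_cycleRange] at h
      rw [h, if_neg (Fin.succ_ne_zero i)]
      push_cast
      rw [Fin.val_succ, pow_succ]
      ring

/-- The wedge product of a one-form with an antisymmetric form, expanded along the one-form. -/
theorem reindex_wedge_one {m k : ℕ} (θ : Form m 1) {α : Form m k} (hα : IsAntisymm α)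
    (x : Vec m) (v : Fin (k + 1) → Vec m) :
    reindex (Nat.add_comm 1 k) (wedge θ α) x v =
      ∑ i : Fin (k + 1),
        (-1 : ℝ) ^ (i : ℕ) * (θ x fun _ => v i) * α x fun j => v (i.succAbove j) := by
  have hk : ((k.factorial : ℕ) : ℝ) ≠ 0 := by positivity
  unfold reindex wedge
  rw [← Equiv.sum_comp (finCongr (Nat.add_comm k 1)).permCongr,
    ← Equiv.sum_comp Equiv.Perm.decomposeFin.symm, Fintype.sum_prod_type, Finset.mul_sum]
  refine Finset.sum_congr rfl fun p _ => ?_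
  have key : ∀ e : Equiv.Perm (Fin k),
      ((Equiv.Perm.sign ((finCongr (Nat.add_comm k 1)).permCongr
          (Equiv.Perm.decomposeFin.symm (p, e))) : ℤ) : ℝ) *
        (θ x fun i => v (Fin.cast (Nat.add_comm 1 k) ((finCongr (Nat.add_comm k 1)).permCongr
          (Equiv.Perm.decomposeFin.symm (p, e)) (Fin.castAdd k i)))) *
        (α x fun j => v (Fin.cast (Nat.add_comm 1 k) ((finCongr (Nat.add_comm k 1)).permCongr
          (Equiv.Perm.decomposeFin.symm (p, e)) (Fin.natAdd 1 j)))) =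
      (-1 : ℝ) ^ (p : ℕ) * (θ x fun _ => v p) * α x fun j => v (p.succAbove j) := by
    intro e
    have h0 : (fun i : Fin 1 => v (Fin.cast (Nat.add_comm 1 k)
        ((finCongr (Nat.add_comm k 1)).permCongr
          (Equiv.Perm.decomposeFin.symm (p, e)) (Fin.castAdd k i)))) = fun _ => v p := by
      funext i
      obtain rfl : i = 0 := Subsingleton.elim _ _
      have : (finCongr (Nat.add_comm k 1)).symm (Fin.castAdd k 0) = (0 : Fin (k + 1)) := by
        ext; simp
      rw [Equiv.permCongr_apply, this, Equiv.Perm.decomposeFin_symm_apply_zero]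
      rfl
    have h1 : (fun j : Fin k => v (Fin.cast (Nat.add_comm 1 k)
        ((finCongr (Nat.add_comm k 1)).permCongr
          (Equiv.Perm.decomposeFin.symm (p, e)) (Fin.natAdd 1 j)))) =
        fun j => v (Equiv.swap 0 p (e j).succ) := by
      funext j
      have : (finCongr (Nat.add_comm k 1)).symm (Fin.natAdd 1 j) = j.succ := by
        ext; simp
      rw [Equiv.permCongr_apply, this, Equiv.Perm.decomposeFin_symm_apply_succ]
      rfl
    have hs := hα x (fun j => v (Equiv.swap 0 p j.succ)) e
    have hsq : ((Equiv.Perm.sign e : ℤ) : ℝ) * ((Equiv.Perm.sign e : ℤ) : ℝ) = 1 := by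
      rcases Int.units_eq_one_or (Equiv.Perm.sign e) with h | h <;> simp [h]
    have hp := hα.swap_zero x v p
    rw [h0, h1, hs, Equiv.Perm.sign_permCongr, Equiv.Perm.decomposeFin.symm_sign]
    calc _ = (((Equiv.Perm.sign e : ℤ) : ℝ) * ((Equiv.Perm.sign e : ℤ) : ℝ)) *
          (θ x fun _ => v p) * ((if p = 0 then 1 else -1 : ℝ) *
            α x fun j => v (Equiv.swap 0 p j.succ)) := by
            split_ifs <;> push_cast <;> ring
      _ = _ := by rw [hsq, hp]; ring
  rw [Finset.sum_congr rfl fun e _ => key e]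
  simp only [Finset.sum_const, Finset.card_univ, Fintype.card_perm, Fintype.card_fin,
    Nat.factorial_one, one_mul, nsmul_eq_mul]
  field_simp

theorem exd_cons_chi {n k : ℕ} {ω : Form (2 * n + 1) k} (hω : IsHorizontal ω)
    (x : Vec (2 * n + 1)) (v : Fin k → Vec (2 * n + 1)) :
    exd ω x (Fin.cons (chi (n := n)) v) = lieChi ω x v := by
  unfold exd lieChi
  rw [Fin.sum_univ_succ, Finset.sum_eq_zero, add_zero]
  · simp
  · intro i _
    have : (fun y => ω y fun j => (Fin.cons (chi (n := n)) v : Fin (k + 1) → Vec (2 * n + 1))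
        (i.succ.succAbove j)) = fun _ => 0 := by
      funext y
      cases k with
      | zero => exact i.elim0
      | succ k => exact hω y _ 0 (by simp)
    rw [this]
    simp

theorem IsAntisymm.lieChi {n k : ℕ} {ω : Form (2 * n + 1) k} (hω : IsAntisymm ω) :
    IsAntisymm (lieChi ω) := by
  intro x v τ
  have h : (fun y => ω y fun i => v (τ i)) =
      fun y => ((Equiv.Perm.sign τ : ℤ) : ℝ) * ω y v := funext fun y => hω y v τ
  unfold MA.lieChi
  rw [h]
  rcases Int.units_eq_one_or (Equiv.Perm.sign τ) with h | h <;> simp [h]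

theorem IsHorizontal.lieChi {n k : ℕ} {ω : Form (2 * n + 1) k} (hω : IsHorizontal ω) :
    IsHorizontal (lieChi ω) := by
  intro x v i hi
  have h : (fun y => ω y v) = fun _ => 0 := funext fun y => hω y v i hi
  unfold MA.lieChi
  rw [h]
  simp

/-- On horizontal antisymmetric forms, `d_p` differentiates along the contact distribution. -/
theorem dproj_apply {n k : ℕ} {ω : Form (2 * n + 1) k} (ha : IsAntisymm ω)
    (hh : IsHorizontal ω) (x : Vec (2 * n + 1)) (v : Fin (k + 1) → Vec (2 * n + 1)) :
    dproj ω x v = ∑ i : Fin (k + 1), (-1 : ℝ) ^ (i : ℕ) *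
      fderiv ℝ (fun y => ω y fun j => v (i.succAbove j)) x
        (v i - (contact (n := n) x fun _ => v i) • chi (n := n)) := by
  have hχ : iprod (chi (n := n)) (exd ω) = lieChi ω := by
    funext y w
    exact exd_cons_chi hh y w
  change exd ω x v - reindex (Nat.add_comm 1 k)
    (wedge contact (iprod (chi (n := n)) (exd ω))) x v = _
  rw [hχ, reindex_wedge_one _ ha.lieChi, exd, ← Finset.sum_sub_distrib]
  refine Finset.sum_congr rfl fun i _ => ?_
  rw [map_sub, map_smul, smul_eq_mul]
  unfold lieChi
  ring

theorem qIdx_ne_uIdx {n : ℕ} (μ : Fin n) : qIdx μ ≠ uIdx := by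
  have := μ.isLt
  simp [qIdx, uIdx, Fin.ext_iff]; omega

theorem qIdx_ne_pIdx {n : ℕ} (μ ν : Fin n) : qIdx μ ≠ pIdx ν := by
  have := μ.isLt
  simp [qIdx, pIdx, Fin.ext_iff]; omega

theorem uIdx_ne_pIdx {n : ℕ} (ν : Fin n) : uIdx ≠ pIdx ν := by
  simp [uIdx, pIdx, Fin.ext_iff]; omega

theorem contact_chi {n : ℕ} (x : Vec (2 * n + 1)) :
    (contact (n := n) x fun _ => chi (n := n)) = 1 := by
  simp [contact, chi, basisVec, qIdx_ne_uIdx]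

theorem contact_basisVec_pIdx {n : ℕ} (x : Vec (2 * n + 1)) (ν : Fin n) :
    (contact (n := n) x fun _ => basisVec (pIdx ν)) = 0 := by
  simp [contact, basisVec, qIdx_ne_pIdx, uIdx_ne_pIdx]

theorem IsHorizontal.dproj {n k : ℕ} {ω : Form (2 * n + 1) k} (ha : IsAntisymm ω)
    (hh : IsHorizontal ω) : IsHorizontal (dproj ω) := by
  intro x v i hi
  rw [dproj_apply ha hh]
  refine Finset.sum_eq_zero fun j _ => ?_
  by_cases hij : i = j
  · subst hij
    rw [hi, contact_chi]
    simp
  · obtain ⟨l, hl⟩ := Fin.exists_succAbove_eq hij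
    have h : (fun y => ω y fun j' => v (j.succAbove j')) = fun _ => 0 :=
      funext fun y => hh y _ l (by rw [hl, hi])
    rw [h]
    simp

theorem qvol_eq_zero {n : ℕ} (x : Vec (2 * n + 1)) (v : Fin n → Vec (2 * n + 1)) (i : Fin n)
    (h : ∀ μ : Fin n, v i (qIdx μ) = 0) : qvol x v = 0 :=
  Matrix.det_eq_zero_of_row_eq_zero i h

theorem isAntisymm_qvol {n : ℕ} : IsAntisymm (qvol (n := n)) := fun _ v τ =>
  Matrix.det_permute τ (Matrix.of fun i j : Fin n => v i (qIdx j))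

theorem chi_qIdx {n : ℕ} (μ : Fin n) : chi (n := n) (qIdx μ) = 0 := by
  simp [chi, basisVec, qIdx_ne_uIdx]

theorem basisVec_pIdx_qIdx {n : ℕ} (ν μ : Fin n) : basisVec (pIdx ν) (qIdx μ) = 0 := by
  simp [basisVec, qIdx_ne_pIdx]

theorem isHorizontal_qvol {n : ℕ} : IsHorizontal (qvol (n := n)) := fun x v i hi =>
  qvol_eq_zero x v i fun μ => by rw [hi, chi_qIdx]

theorem IsAntisymm.fsmul {m k : ℕ} {ω : Form m k} (hω : IsAntisymm ω) (f : Vec m → ℝ) :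
    IsAntisymm (fsmul f ω) := fun x v τ => by
  simp only [MA.fsmul, hω x v τ]
  ring

theorem IsHorizontal.fsmul {n k : ℕ} {ω : Form (2 * n + 1) k} (hω : IsHorizontal ω)
    (f : Vec (2 * n + 1) → ℝ) : IsHorizontal (fsmul f ω) := fun x v i hi => by
  simp only [MA.fsmul, hω x v i hi, mul_zero]

theorem IsAntisymm.cons {m k : ℕ} {ω : Form m (k + 1)} (hω : IsAntisymm ω) (u : Vec m)
    (x : Vec m) (v : Fin k → Vec m) (τ : Equiv.Perm (Fin k)) :
    ω x (Fin.cons u fun i => v (τ i)) = ((Equiv.Perm.sign τ : ℤ) : ℝ) * ω x (Fin.cons u v) := by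
  have h := hω x (Fin.cons u v) (Equiv.Perm.decomposeFin.symm (0, τ))
  rw [Equiv.Perm.decomposeFin.symm_sign] at h
  rw [if_pos rfl, one_mul] at h
  rw [← h]
  congr 1
  funext i
  cases i using Fin.cases <;> simp

/-- The form `-Σ_μ (∂L/∂p_μ) β_μ`. -/
def momentumForm {m : ℕ} (L : Vec (2 * (m + 1) + 1) → ℝ) : Form (2 * (m + 1) + 1) m :=
  fun x w => -∑ μ : Fin (m + 1), pd (pIdx μ) L x * qvol x (Fin.cons (basisVec (qIdx μ)) w)

theorem isAntisymm_momentumForm {m : ℕ} (L : Vec (2 * (m + 1) + 1) → ℝ) :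
    IsAntisymm (momentumForm L) := by
  intro x v τ
  simp only [momentumForm, isAntisymm_qvol.cons, mul_neg, Finset.mul_sum]
  congr 1
  refine Finset.sum_congr rfl fun μ _ => ?_
  ring

theorem isHorizontal_momentumForm {m : ℕ} (L : Vec (2 * (m + 1) + 1) → ℝ) :
    IsHorizontal (momentumForm L) := by
  intro x v i hi
  simp only [momentumForm, neg_eq_zero]
  refine Finset.sum_eq_zero fun μ _ => ?_
  rw [isHorizontal_qvol x _ i.succ (by simpa using hi), mul_zero]

/-- Contraction of `d_p ω` with `∂_{q^μ}` and `∂_{p_μ}`, for a form `ω` killed by all `∂_{p_μ}`. -/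
theorem dproj_cons_cons {n k : ℕ} {ω : Form (2 * n + 1) (k + 1)} (ha : IsAntisymm ω)
    (hh : IsHorizontal ω) (μ : Fin n)
    (hp : ∀ y v i, v i = basisVec (pIdx μ) → ω y v = 0)
    (x : Vec (2 * n + 1)) (v : Fin k → Vec (2 * n + 1)) :
    dproj ω x (Fin.cons (basisVec (qIdx μ)) (Fin.cons (basisVec (pIdx μ)) v)) =
      -pd (pIdx μ) (fun y => ω y (Fin.cons (basisVec (qIdx μ)) v)) x := by
  set w : Fin (k + 1 + 1) → Vec (2 * n + 1) :=
    Fin.cons (basisVec (qIdx μ)) (Fin.cons (basisVec (pIdx μ)) v) with hw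
  have hw1 : w 1 = basisVec (pIdx μ) := rfl
  rw [dproj_apply ha hh, Finset.sum_eq_single 1]
  · have : (fun j => w ((1 : Fin (k + 1 + 1)).succAbove j)) =
        Fin.cons (basisVec (qIdx μ)) v := by
      funext j
      cases j using Fin.cases with
      | zero => rfl
      | succ j =>
        have : (1 : Fin (k + 1 + 1)).succAbove j.succ = j.succ.succ := by
          rw [← Fin.succ_zero_eq_one, Fin.succ_succAbove_succ, Fin.succAbove_zero]
        rw [this]; rfl
    rw [this, hw1, contact_basisVec_pIdx]
    simp [pd]
  · intro i _ hi
    obtain ⟨l, hl⟩ := Fin.exists_succAbove_eq hi.symm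
    have h : (fun y => ω y fun j => w (i.succAbove j)) = fun _ => 0 :=
      funext fun y => hp y _ l (by rw [hl, hw1])
    rw [h]
    simp
  · simp

theorem botOp_apply {n k : ℕ} (ω : Form (2 * n + 1) (k + 2)) (x : Vec (2 * n + 1))
    (v : Fin k → Vec (2 * n + 1)) :
    botOp ω x v = ∑ μ : Fin n,
      ω x (Fin.cons (basisVec (qIdx μ)) (Fin.cons (basisVec (pIdx μ)) v)) := by
  unfold botOp
  rw [Finset.sum_apply, Finset.sum_apply]
  rfl

theorem botOp_dproj_fsmul_qvol {m : ℕ} {L : Vec (2 * (m + 1) + 1) → ℝ}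
    (hL : Differentiable ℝ L) : botOp (dproj (fsmul L qvol)) = momentumForm L := by
  funext x v
  rw [botOp_apply, momentumForm, ← Finset.sum_neg_distrib]
  refine Finset.sum_congr rfl fun μ _ => ?_
  rw [dproj_cons_cons (isAntisymm_qvol.fsmul L) (isHorizontal_qvol.fsmul L)]
  · have : (fun y => fsmul L qvol y (Fin.cons (basisVec (qIdx μ)) v)) =
        fun y => L y * qvol x (Fin.cons (basisVec (qIdx μ)) v) := rfl
    rw [this, pd, fderiv_mul_const (hL x)]
    simp [pd, mul_comm]
  · intro y w i hi
    rw [fsmul, qvol_eq_zero y w i fun ν => by rw [hi, basisVec_pIdx_qIdx], mul_zero]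

theorem pd_pd_comm {m : ℕ} {f : Vec m → ℝ} (hf : ContDiff ℝ (⊤ : ℕ∞) f) (i j : Fin m)
    (x : Vec m) : pd i (pd j f) x = pd j (pd i f) x := by
  have hd : DifferentiableAt ℝ (fderiv ℝ f) x :=
    ((hf.fderiv_right (m := 1) (by norm_cast)).differentiable one_ne_zero) x
  have hsymm : IsSymmSndFDerivAt ℝ f x :=
    hf.contDiffAt.isSymmSndFDerivAt (by simp; norm_cast)
  have h : ∀ i j : Fin m, pd i (pd j f) x = fderiv ℝ (fderiv ℝ f) x (basisVec i) (basisVec j) := by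
    intro i j
    unfold pd
    rw [fderiv_clm_apply hd (differentiableAt_const _)]
    simp
  rw [h, h, hsymm.eq]

theorem differentiable_pd {m : ℕ} {f : Vec m → ℝ} (hf : ContDiff ℝ (⊤ : ℕ∞) f) (i : Fin m) :
    Differentiable ℝ (pd i f) :=
  ((hf.fderiv_right (m := 1) (by norm_cast)).differentiable one_ne_zero).clm_apply
    (differentiable_const _)

theorem qvol_cons_cons_swap {k : ℕ} (x a b : Vec (2 * (k + 2) + 1))
    (v : Fin k → Vec (2 * (k + 2) + 1)) :
    qvol (n := k + 2) x (Fin.cons a (Fin.cons b v)) =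
      -qvol (n := k + 2) x (Fin.cons b (Fin.cons a v)) := by
  have h := isAntisymm_qvol (n := k + 2) x (Fin.cons b (Fin.cons a v)) (Equiv.swap 0 1)
  rw [Equiv.Perm.sign_swap (by simp)] at h
  have h' : (fun i => (Fin.cons b (Fin.cons a v) : Fin (k + 2) → Vec (2 * (k + 2) + 1))
      (Equiv.swap 0 1 i)) = Fin.cons a (Fin.cons b v) := by
    funext i
    cases i using Fin.cases with
    | zero => rw [Equiv.swap_apply_left]; rfl
    | succ i =>
      cases i using Fin.cases with
      | zero => rw [Fin.succ_zero_eq_one, Equiv.swap_apply_right]; rfl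
      | succ i =>
        rw [Equiv.swap_apply_of_ne_of_ne (Fin.succ_ne_zero _)
          (by simp [Fin.ext_iff])]
        rfl
  rw [h'] at h
  simpa using h

theorem botOp_dproj_momentumForm {k : ℕ} {L : Vec (2 * (k + 2) + 1) → ℝ}
    (hL : ContDiff ℝ (⊤ : ℕ∞) L) : botOp (dproj (momentumForm (m := k + 1) L)) = 0 := by
  funext x v
  have hterm : ∀ ρ : Fin (k + 2),
      dproj (momentumForm (m := k + 1) L) x
        (Fin.cons (basisVec (qIdx ρ)) (Fin.cons (basisVec (pIdx ρ)) v)) =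
      ∑ μ : Fin (k + 2), pd (pIdx ρ) (pd (pIdx μ) L) x *
        qvol x (Fin.cons (basisVec (qIdx μ)) (Fin.cons (basisVec (qIdx ρ)) v)) := by
    intro ρ
    rw [dproj_cons_cons (isAntisymm_momentumForm L) (isHorizontal_momentumForm L)]
    · have : (fun y => momentumForm L y (Fin.cons (basisVec (qIdx ρ)) v)) =
          fun y => -∑ μ : Fin (k + 2), pd (pIdx μ) L y *
            qvol x (Fin.cons (basisVec (qIdx μ)) (Fin.cons (basisVec (qIdx ρ)) v)) := rfl
      rw [this, pd, fderiv_fun_neg, fderiv_fun_sum fun μ _ =>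
        ((differentiable_pd hL (pIdx μ)).mul_const _) x]
      simp only [neg_apply, neg_neg, sum_apply]
      refine Finset.sum_congr rfl fun μ _ => ?_
      rw [fderiv_mul_const (differentiable_pd hL (pIdx μ) x)]
      simp [pd, mul_comm]
    · intro y w i hi
      simp only [momentumForm, neg_eq_zero]
      refine Finset.sum_eq_zero fun μ _ => ?_
      rw [qvol_eq_zero y _ i.succ fun ν => by
        rw [Fin.cons_succ, hi, basisVec_pIdx_qIdx], mul_zero]
  rw [botOp_apply, Finset.sum_congr rfl fun ρ _ => hterm ρ]
  have hneg : ∀ S : ℝ, S = -S → S = 0 := fun S h => by linarith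
  refine hneg _ ?_
  conv_lhs => rw [Finset.sum_comm]
  rw [← Finset.sum_neg_distrib]
  refine Finset.sum_congr rfl fun μ _ => ?_
  rw [← Finset.sum_neg_distrib]
  refine Finset.sum_congr rfl fun ρ _ => ?_
  rw [pd_pd_comm hL, qvol_cons_cons_swap]
  ring

theorem botOp_lieChi_fsmul_qvol {k : ℕ} (L : Vec (2 * (k + 2) + 1) → ℝ) :
    botOp (lieChi (fsmul L (qvol (n := k + 2)))) = 0 := by
  funext x v
  rw [botOp_apply]
  refine Finset.sum_eq_zero fun μ _ => ?_
  have h : (fun y => fsmul L (qvol (n := k + 2)) y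
      (Fin.cons (basisVec (qIdx μ)) (Fin.cons (basisVec (pIdx μ)) v))) = fun _ => 0 := by
    funext y
    rw [fsmul, qvol_eq_zero y _ 1 fun ν => ?_, mul_zero]
    exact basisVec_pIdx_qIdx μ ν
  rw [lieChi, h]
  simp

theorem euler_fsmul_qvol {m : ℕ} {L : Vec (2 * (m + 1) + 1) → ℝ} (hL : Differentiable ℝ L) :
    euler (n := m + 1) (fsmul L qvol) =
      dproj (momentumForm L) + lieChi (fsmul L qvol) := by
  rw [← botOp_dproj_fsmul_qvol hL]
  rfl

/-- for every smooth function `L` on ℝ^{2n+1}, the n-form `E(Lβ)` is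
effective: `χ ⌟ E(Lβ) = 0` and `⊥E(Lβ) = 0`. -/
theorem euler_of_lagrangian_is_effective (n : ℕ)
    (L : Vec (2 * n + 1) → ℝ) (hL : ContDiff ℝ (⊤ : ℕ∞) L) :
    Effective (euler (fsmul L qvol)) := by
  cases n with
  | zero => exact ⟨rfl, by simp [botOp]⟩
  | succ m =>
    rw [euler_fsmul_qvol (hL.differentiable (by simp))]
    refine ⟨?_, ?_⟩
    · funext x v
      change dproj (momentumForm L) x (Fin.cons chi v) +
        lieChi (fsmul L qvol) x (Fin.cons chi v) = 0
      rw [IsHorizontal.dproj (isAntisymm_momentumForm L) (isHorizontal_momentumForm L) x _ 0 rfl,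
        (isHorizontal_qvol.fsmul L).lieChi x _ 0 rfl, add_zero]
    · cases m with
      | zero => exact Finset.sum_eq_zero fun μ _ => rfl
      | succ k =>
        have hadd : ∀ α γ : Form (2 * (k + 2) + 1) (k + 2),
            botOp (n := k + 2) (α + γ) = botOp (n := k + 2) α + botOp (n := k + 2) γ := by
          intro α γ
          funext x v
          rw [Pi.add_apply, Pi.add_apply, botOp_apply, botOp_apply, botOp_apply,
            ← Finset.sum_add_distrib]
          rfl
        exact (hadd _ _).trans (by
          rw [botOp_dproj_momentumForm hL, botOp_lieChi_fsmul_qvol, add_zero])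

end MA
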